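/- arXiv:2107.06605 — 3 statements merged into one kernel-verified Lean document; each statement's English description precedes it below -/
import Mathlib

section
/- Let n ∈ ℕ, let P be an n×n real diagonal matrix whose diagonal entries all lie in {0,1}, let Q = 1 − P (so Q is the complementary 0/1 diagonal projection), let M be an n×n real matrix and q ∈ ℝ. Suppose the matrix R := q·P − P·M + Q is invertible, and set U := R⁻¹ · Q. Then: (a) for every index x with P x x = 1 and every index y, q·U x y − (M·U) x y = 0; (b) for every index x with P x x = 0 and every index y, U x y = 1 if x = y and U x y = 0 otherwise. (This establishes that the matrix formulas (2.25) and (2.27) of the paper solve the two-point boundary linear systems for the first-passage quantities u₁,ₙ⁺ and uₙ⁻ in Proposition 2.1.) -/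
open Matrix

/-- **The matrix formula `U = (q·P − P·M + Q)⁻¹·Q` solves the two-point boundary linear system.**
Let `P` be an `n×n` diagonal 0/1 matrix, `Q = 1 − P`, `M` an arbitrary real matrix and `q ∈ ℝ`.
If `R = q·P − P·M + Q` is invertible and `U = R⁻¹·Q`, then on the rows where `P x x = 1` one has
`q·U x y − (M·U) x y = 0`, and on the rows where `P x x = 0` one has `U x y = δ_{x y}`. -/
theorem stmt3 {n : ℕ} (P M : Matrix (Fin n) (Fin n) ℝ) (q : ℝ)
    (hPdiag : ∀ i j : Fin n, i ≠ j → P i j = 0)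
    (hP01 : ∀ i : Fin n, P i i = 0 ∨ P i i = 1)
    (hR : IsUnit (q • P - P * M + (1 - P))) :
    (∀ x y : Fin n, P x x = 1 →
        q * ((q • P - P * M + (1 - P))⁻¹ * (1 - P)) x y
          - (M * ((q • P - P * M + (1 - P))⁻¹ * (1 - P))) x y = 0) ∧
    (∀ x y : Fin n, P x x = 0 →
        ((q • P - P * M + (1 - P))⁻¹ * (1 - P)) x y = if x = y then 1 else 0) := by
  have hU : (q • P - P * M + (1 - P)) * ((q • P - P * M + (1 - P))⁻¹ * (1 - P)) = 1 - P := by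
    rw [← Matrix.mul_assoc,
      Matrix.mul_nonsing_inv _ ((Matrix.isUnit_iff_isUnit_det _).1 hR), Matrix.one_mul]
  generalize (q • P - P * M + (1 - P))⁻¹ * (1 - P) = U at hU ⊢
  have hPmul : ∀ (A : Matrix (Fin n) (Fin n) ℝ) (x y : Fin n),
      (P * A) x y = P x x * A x y := by
    intro A x y
    rw [Matrix.mul_apply]
    refine Finset.sum_eq_single x ?_ ?_
    · intro b _ hb
      rw [hPdiag x b (Ne.symm hb), zero_mul]
    · intro h
      exact absurd (Finset.mem_univ x) h
  have key : ∀ x y : Fin n, q * (P x x * U x y) - P x x * (M * U) x y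
      + (U x y - P x x * U x y) = (if x = y then 1 else 0) - P x y := by
    intro x y
    have h := congrFun (congrFun hU x) y
    rw [Matrix.add_mul, Matrix.sub_mul, Matrix.sub_mul, Matrix.smul_mul, Matrix.mul_assoc,
      Matrix.one_mul] at h
    simpa only [Matrix.add_apply, Matrix.sub_apply, Matrix.smul_apply, hPmul, smul_eq_mul,
      Matrix.one_apply] using h
  constructor
  · intro x y hx
    have h := key x y
    by_cases hxy : x = y
    · subst hxy
      simp only [hx, if_true] at h
      linarith
    · rw [hPdiag x y hxy, if_neg hxy, hx] at h
      linarith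
  · intro x y hx
    have h := key x y
    have hxy0 : P x y = 0 := by
      by_cases hxy : x = y
      · subst hxy; exact hx
      · exact hPdiag x y hxy
    rw [hx, hxy0] at h
    linarith
end

section
/- Let μ, σ : ℝ → ℝ, q, r, b ∈ ℝ, and let ψ⁺, ψ⁻ : ℝ → ℝ be twice differentiable on an open interval I containing b and satisfy μ(x)ψ'(x) + (1/2)σ(x)²ψ''(x) − qψ(x) = 0 for all x ∈ I. Define N(x) = ψ⁺(r)ψ⁻(x) − ψ⁺(x)ψ⁻(r) and suppose N(b) ≠ 0. Then the function g(β) := N(b)/N(β) is twice differentiable at b, g(b) = 1, and the nonlinear boundary identity μ(b)·g'(b) − σ(b)²·(g'(b))² + (1/2)σ(b)²·g''(b) + q = 0 holds. (This is the identity (4.39) of Lemma 4.3 of the paper, μ(L)∂_b u⁻(q,L,L) − σ²(L)(∂_b u⁻(q,L,L))² + ½σ²(L)∂_{bb}u⁻(q,L,L) + q = 0, where u⁻(q,x,β) = N(x)/N(β) so that the partial derivatives of u⁻ in the boundary variable β at x = β = b are exactly g'(b) and g''(b).) -/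
/-- The boundary-perturbation function `g(β) = N(b)/N(β)`, where
`N(x) = ψ⁺(r)ψ⁻(x) − ψ⁺(x)ψ⁻(r)`. -/
noncomputable def boundaryFun (ψp ψm : ℝ → ℝ) (r b β : ℝ) : ℝ :=
  (ψp r * ψm b - ψp b * ψm r) / (ψp r * ψm β - ψp β * ψm r)

/-- **The nonlinear boundary identity (4.39) of Lemma 4.3.**
Let `ψ⁺, ψ⁻` be twice differentiable solutions of `μ(x)ψ' + ½σ(x)²ψ'' − qψ = 0` on an open
interval `(c₁, c₂)` containing `b`; put `N(x) = ψ⁺(r)ψ⁻(x) − ψ⁺(x)ψ⁻(r)` and assume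
`N(b) ≠ 0`.  Then `g(β) = N(b)/N(β)` is twice differentiable at `b`, `g(b) = 1`, and
`μ(b)·g'(b) − σ(b)²·(g'(b))² + ½σ(b)²·g''(b) + q = 0`. -/
theorem stmt7 (μ σ : ℝ → ℝ) (q r b c₁ c₂ : ℝ) (hb : b ∈ Set.Ioo c₁ c₂)
    (ψp ψm ψp' ψp'' ψm' ψm'' : ℝ → ℝ)
    (hψp1 : ∀ x ∈ Set.Ioo c₁ c₂, HasDerivAt ψp (ψp' x) x)
    (hψp2 : ∀ x ∈ Set.Ioo c₁ c₂, HasDerivAt ψp' (ψp'' x) x)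
    (hψpode : ∀ x ∈ Set.Ioo c₁ c₂,
      μ x * ψp' x + (1 / 2) * (σ x) ^ 2 * ψp'' x - q * ψp x = 0)
    (hψm1 : ∀ x ∈ Set.Ioo c₁ c₂, HasDerivAt ψm (ψm' x) x)
    (hψm2 : ∀ x ∈ Set.Ioo c₁ c₂, HasDerivAt ψm' (ψm'' x) x)
    (hψmode : ∀ x ∈ Set.Ioo c₁ c₂,
      μ x * ψm' x + (1 / 2) * (σ x) ^ 2 * ψm'' x - q * ψm x = 0)
    (hN : ψp r * ψm b - ψp b * ψm r ≠ 0) :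
    DifferentiableAt ℝ (boundaryFun ψp ψm r b) b ∧
    DifferentiableAt ℝ (deriv (boundaryFun ψp ψm r b)) b ∧
    boundaryFun ψp ψm r b b = 1 ∧
    μ b * deriv (boundaryFun ψp ψm r b) b
      - (σ b) ^ 2 * (deriv (boundaryFun ψp ψm r b) b) ^ 2
      + (1 / 2) * (σ b) ^ 2 * deriv (deriv (boundaryFun ψp ψm r b)) b + q = 0 := by
  set N : ℝ → ℝ := fun x => ψp r * ψm x - ψp x * ψm r with hNdef
  set dN : ℝ → ℝ := fun x => ψp r * ψm' x - ψp' x * ψm r with hdN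
  set ddN : ℝ → ℝ := fun x => ψp r * ψm'' x - ψp'' x * ψm r with hddN
  have hNb : N b ≠ 0 := hN
  have h1 : ∀ x ∈ Set.Ioo c₁ c₂, HasDerivAt N (dN x) x := fun x hx =>
    ((hψm1 x hx).const_mul _).sub ((hψp1 x hx).mul_const _)
  have h2 : ∀ x ∈ Set.Ioo c₁ c₂, HasDerivAt dN (ddN x) x := fun x hx =>
    ((hψm2 x hx).const_mul _).sub ((hψp2 x hx).mul_const _)
  have hode : μ b * dN b + (1 / 2) * (σ b) ^ 2 * ddN b - q * N b = 0 := by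
    simp only [hNdef, hdN, hddN]
    linear_combination ψp r * hψmode b hb - ψm r * hψpode b hb
  have hg : boundaryFun ψp ψm r b = fun x => N b / N x := rfl
  have hd : ∀ x ∈ Set.Ioo c₁ c₂, N x ≠ 0 →
      HasDerivAt (boundaryFun ψp ψm r b) (-(N b * dN x) / N x ^ 2) x := by
    intro x hx hx0
    rw [hg]
    have := (hasDerivAt_const x (N b)).fun_div (h1 x hx) hx0
    simpa using this
  have hev : deriv (boundaryFun ψp ψm r b) =ᶠ[nhds b] fun x => -(N b * dN x) / N x ^ 2 := by
    filter_upwards [isOpen_Ioo.mem_nhds hb, (h1 b hb).continuousAt.eventually_ne hNb]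
      with x hx hx0
    exact (hd x hx hx0).deriv
  have hd2 := (((h2 b hb).const_mul (N b)).fun_neg.fun_div ((h1 b hb).fun_pow 2)
    (pow_ne_zero 2 hNb)).congr_of_eventuallyEq hev
  refine ⟨(hd b hb hNb).differentiableAt, hd2.differentiableAt, div_self hN, ?_⟩
  rw [hd2.deriv, (hd b hb hNb).deriv]
  have hq : q = (μ b * dN b + (1 / 2) * (σ b) ^ 2 * ddN b) / N b := by
    field_simp
    linear_combination -2 * hode
  rw [hq]
  generalize N b = n at *
  field_simp
  ring
end

section
/- Let n ∈ ℕ, identify indices with {0, 1, …, n−1}, and let G be an n×n real tridiagonal matrix (G i j = 0 whenever |i − j| > 1). Let k be an index with 1 ≤ k ≤ n−1, let P be the diagonal matrix with P i i = 1 for i < k and P i i = 0 for i ≥ k, let Q = 1 − P, and let q ∈ ℝ. Suppose R := q·P − P·G + Q is invertible and set U := R⁻¹·Q. Then for every index i < k and every index j ≠ k, U i j = 0; that is, the only possibly nonzero entries of U in the rows i < k lie in column k. (This is the matrix form of the claim in Remark 2.2 of the paper: for a birth-and-death chain, the Laplace transform u₁,ₙ⁺(q,x;z) of the upcrossing first passage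 time started below the barrier is nonzero only when the landing state z equals L⁺, the first grid point at or above the barrier.) -/
open Matrix

/-- The diagonal 0/1 projection onto the first `k` coordinates. -/
noncomputable def projBelow (n k : ℕ) : Matrix (Fin n) (Fin n) ℝ :=
  Matrix.diagonal fun i => if (i : ℕ) < k then 1 else 0

/-- **Sparsity of the first-passage Laplace transform for a birth-and-death chain.**
Let `G` be an `n×n` real tridiagonal matrix, `1 ≤ k ≤ n−1`, `P` the diagonal projection onto
the first `k` coordinates, `Q = 1 − P`, and suppose `R = q·P − P·G + Q` is invertible with
`U = R⁻¹·Q`.  Then for every row `i < k` the only possibly nonzero entry of `U` lies in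
column `k`: `U i j = 0` whenever `i < k` and `j ≠ k`. -/
theorem stmt13 {n : ℕ} (G : Matrix (Fin n) (Fin n) ℝ)
    (htri : ∀ i j : Fin n, ((i : ℕ) + 1 < (j : ℕ) ∨ (j : ℕ) + 1 < (i : ℕ)) → G i j = 0)
    (k : ℕ) (hk1 : 1 ≤ k) (hk2 : k ≤ n - 1) (q : ℝ)
    (hR : IsUnit (q • projBelow n k - projBelow n k * G + (1 - projBelow n k))) :
    ∀ i j : Fin n, (i : ℕ) < k → (j : ℕ) ≠ k →
      ((q • projBelow n k - projBelow n k * G + (1 - projBelow n k))⁻¹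
          * (1 - projBelow n k)) i j = 0 := by
  intro i j hi hj
  have hQ : (1 - projBelow n k)
      = Matrix.diagonal (fun i : Fin n => if (i : ℕ) < k then (0 : ℝ) else 1) := by
    ext a b
    by_cases hab : a = b
    · subst hab
      by_cases h : (a : ℕ) < k <;> simp [projBelow, h]
    · simp [projBelow, hab]
  rcases lt_or_gt_of_ne hj with hlt | hgt
  · rw [hQ, Matrix.mul_diagonal]
    simp [hlt]
  · have hcol : (q • projBelow n k - projBelow n k * G + (1 - projBelow n k)) *ᵥ Pi.single j 1
        = Pi.single j 1 := by
      ext a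
      rw [hQ, Matrix.mulVec_single_one]
      by_cases ha : (a : ℕ) < k
      · have haj : a ≠ j := by rintro rfl; omega
        have hG : G a j = 0 := htri a j (Or.inl (by omega))
        simp [projBelow, Matrix.diagonal_mul, haj, hG]
      · by_cases haj : a = j
        · subst haj
          simp [projBelow, Matrix.diagonal_mul, ha]
        · simp [projBelow, Matrix.diagonal_mul, ha, haj]
    have hinv := Matrix.nonsing_inv_mul _ ((Matrix.isUnit_iff_isUnit_det _).mp hR)
    generalize q • projBelow n k - projBelow n k * G + (1 - projBelow n k) = R at *
    have h2 : R⁻¹ *ᵥ Pi.single j 1 = Pi.single j 1 := by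
      conv_lhs => rw [← hcol]
      rw [Matrix.mulVec_mulVec, hinv, Matrix.one_mulVec]
    have h3 := congrFun h2 i
    have hij : i ≠ j := by rintro rfl; omega
    rw [Matrix.mulVec_single_one] at h3
    rw [hQ, Matrix.mul_diagonal]
    simp [hij] at h3
    simp [h3]
end
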